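/- Let μ be a stationary process on A^ℤ (A a finite alphabet) with shift T and Pinsker σ-algebra Π. Let B be a finite alphabet, let ζ_0 : A^ℤ → B be a Π-measurable random variable, and set ζ_i := ζ_0 ∘ T^i for i ∈ ℤ. Assume the σ-algebra generated by (ζ_i)_{i∈ℤ} equals Π modulo μ-null sets. If the stationary process ζ (the pushforward of μ under x ↦ (ζ_i(x))_{i∈ℤ}, a shift-invariant measure on B^ℤ) is 3-fold mixing, then μ is 3-fold mixing. -/

import Mathlib

open MeasureTheory Filter ProbabilityTheory

/-- The coordinate shift `T` on `A^ℤ`: `(T x) i = x (i+1)`. -/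
def shiftT (A : Type*) : (ℤ → A) → (ℤ → A) := fun x i => x (i + 1)

/-- The window `ξ_p^{p+ℓ} = (x_p, …, x_{p+ℓ})` of length `ℓ+1` starting at position `p`. -/
def window {A : Type*} (ℓ : ℕ) (p : ℤ) (x : ℤ → A) : Fin (ℓ + 1) → A :=
  fun i => x (p + (i : ℕ))

/-- 2-fold mixing of a stationary process `μ` on `A^ℤ`. -/
def Mixing2 {A : Type*} [MeasurableSpace A] (μ : Measure (ℤ → A)) : Prop :=
  ∀ (ℓ : ℕ) (E1 E2 : Set (Fin (ℓ + 1) → A)),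
    Tendsto (fun p : ℕ =>
        (μ {x | window ℓ 0 x ∈ E1 ∧ window ℓ (p : ℤ) x ∈ E2}).toReal -
          (μ {x | window ℓ 0 x ∈ E1}).toReal * (μ {x | window ℓ 0 x ∈ E2}).toReal)
      atTop (nhds 0)

/-- 3-fold mixing of a stationary process `μ` on `A^ℤ`. -/
def Mixing3 {A : Type*} [MeasurableSpace A] (μ : Measure (ℤ → A)) : Prop :=
  ∀ (ℓ : ℕ) (E1 E2 E3 : Set (Fin (ℓ + 1) → A)),
    Tendsto (fun pq : ℕ × ℕ =>
        (μ {x | window ℓ 0 x ∈ E1 ∧ window ℓ (pq.1 : ℤ) x ∈ E2 ∧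
              window ℓ ((pq.1 : ℤ) + (pq.2 : ℤ)) x ∈ E3}).toReal -
          (μ {x | window ℓ 0 x ∈ E1}).toReal * (μ {x | window ℓ 0 x ∈ E2}).toReal *
            (μ {x | window ℓ 0 x ∈ E3}).toReal)
      (atTop ×ˢ atTop) (nhds 0)

/-- The cylinder set `[w] = {x : (x_0,…,x_{m-1}) = w}` associated with a word `w ∈ A^m`. -/
def cylSet {A : Type*} (m : ℕ) (w : Fin m → A) : Set (ℤ → A) :=
  {x | ∀ i : Fin m, x ((i : ℕ) : ℤ) = w i}

/-- `H_m(μ) = -∑_{w ∈ A^m} μ([w]) log μ([w])`. -/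
noncomputable def Hm {A : Type*} [Fintype A] [MeasurableSpace A]
    (μ : Measure (ℤ → A)) (m : ℕ) : ℝ :=
  -∑ w : Fin m → A, (μ (cylSet m w)).toReal * Real.log (μ (cylSet m w)).toReal

/-- `μ` is a periodic process: for some `n ≥ 1`, `μ`-a.e. `x` is `n`-periodic. -/
def PeriodicProcess {A : Type*} [MeasurableSpace A] (μ : Measure (ℤ → A)) : Prop :=
  ∃ n : ℕ, 1 ≤ n ∧ ∀ᵐ x ∂μ, ∀ i : ℤ, x (i + (n : ℤ)) = x i

/-- The simultaneous shift `T × T × T` on the triple product. -/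
def shiftT3 (A : Type*) : (ℤ → A) × (ℤ → A) × (ℤ → A) → (ℤ → A) × (ℤ → A) × (ℤ → A) :=
  fun p => (shiftT A p.1, shiftT A p.2.1, shiftT A p.2.2)

/-- `lam` is a 3-fold self-joining of `μ`: it is invariant under the simultaneous shift
and its three one-dimensional marginals are equal to `μ`. -/
def IsSelfJoining3 {A : Type*} [MeasurableSpace A] (μ : Measure (ℤ → A))
    (lam : Measure ((ℤ → A) × (ℤ → A) × (ℤ → A))) : Prop :=
  lam.map (shiftT3 A) = lam ∧
    lam.map (fun p => p.1) = μ ∧ lam.map (fun p => p.2.1) = μ ∧ lam.map (fun p => p.2.2) = μ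

/-- The coordinates `(ξ, ξ', ξ'')` of `lam` are pairwise independent: all three
two-dimensional marginals equal `μ ⊗ μ`. -/
def PairwiseIndepCoords {A : Type*} [MeasurableSpace A] (μ : Measure (ℤ → A))
    (lam : Measure ((ℤ → A) × (ℤ → A) × (ℤ → A))) : Prop :=
  lam.map (fun p => (p.1, p.2.1)) = μ.prod μ ∧
    lam.map (fun p => (p.1, p.2.2)) = μ.prod μ ∧
      lam.map (fun p => (p.2.1, p.2.2)) = μ.prod μ

/-- A 3-dot-type self-joining of `μ`: a 3-fold self-joining with pairwise independent
coordinates such that `ξ''_i = f (ξ_i, ξ'_i)` a.s. for every `i`, for some `f : A × A → A`. -/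
def IsThreeDotJoining {A : Type*} [MeasurableSpace A] (μ : Measure (ℤ → A))
    (lam : Measure ((ℤ → A) × (ℤ → A) × (ℤ → A))) : Prop :=
  IsSelfJoining3 μ lam ∧ PairwiseIndepCoords μ lam ∧
    ∃ f : A → A → A, ∀ i : ℤ, ∀ᵐ p ∂lam, p.2.2 i = f (p.1 i) (p.2.1 i)

open scoped symmDiff

/-- The Pinsker σ-algebra (tail field) `Π = ⋂_{p ∈ ℤ} σ(ξ_i : i ≤ p)` of a process on `A^ℤ`. -/
def pinskerAlg (A : Type*) [MeasurableSpace A] : MeasurableSpace (ℤ → A) :=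
  ⨅ p : ℤ, ⨆ i : ℤ, ⨆ _ : i ≤ p,
    MeasurableSpace.comap (fun x : ℤ → A => x i) inferInstance

/-- The shift `T^n` (for `n ∈ ℤ`) on `A^ℤ`: `(T^n x) i = x (i + n)`. -/
def shiftZ (A : Type*) (n : ℤ) : (ℤ → A) → (ℤ → A) := fun x i => x (i + n)

/-- The σ-algebra generated by the factor process `(ζ_i)_{i∈ℤ} = (ζ_0 ∘ T^i)_{i∈ℤ}`. -/
def factorAlg (A : Type*) {B : Type*} [MeasurableSpace B] (ζ0 : (ℤ → A) → B) :
    MeasurableSpace (ℤ → A) :=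
  ⨆ i : ℤ, MeasurableSpace.comap (fun x => ζ0 (shiftZ A i x)) inferInstance


open scoped InnerProductSpace

theorem exists_mem_iInf_inner_sub_le {E : Type*} [NormedAddCommGroup E] [InnerProductSpace ℝ E]
    [CompleteSpace E] (K : ℕ → Submodule ℝ E) (hK : Antitone K)
    (hc : ∀ n, IsClosed (K n : Set E)) (x : E) :
    ∃ y, (∀ n, y ∈ K n) ∧ ∀ ε > 0, ∃ N, ∀ h ∈ K N, |⟪h, x - y⟫_ℝ| ≤ ε * ‖h‖ := by
  have hmono : Monotone fun n => (K n)ᗮ := fun a b hab => Submodule.orthogonal_le (hK hab)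
  have hlim := Submodule.starProjection_tendsto_closure_iSup (fun n => (K n)ᗮ) hmono x
  set V := (⨆ n, (K n)ᗮ).topologicalClosure with hV
  refine ⟨x - V.starProjection x, fun n => ?_, fun ε hε => ?_⟩
  · have h1 : x - V.starProjection x ∈ Vᗮ := V.sub_starProjection_mem_orthogonal x
    have h2 : Vᗮ ≤ (K n)ᗮᗮ := Submodule.orthogonal_le
      ((le_iSup (fun n => (K n)ᗮ) n).trans (Submodule.le_topologicalClosure _))
    have h3 := h2 h1
    rwa [Submodule.orthogonal_orthogonal_eq_closure, (hc n).submodule_topologicalClosure_eq] at h3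
  · obtain ⟨N, hN⟩ := (Metric.tendsto_atTop.1 hlim) ε hε
    refine ⟨N, fun h hh => ?_⟩
    have h0 : ⟪h, ((K N)ᗮ).starProjection x⟫_ℝ = 0 :=
      Submodule.inner_right_of_mem_orthogonal hh (Submodule.starProjection_apply_mem _ _)
    have h1 : ⟪h, x - (x - V.starProjection x)⟫_ℝ
        = - ⟪h, ((K N)ᗮ).starProjection x - V.starProjection x⟫_ℝ := by
      rw [inner_sub_right _ (((K N)ᗮ).starProjection x), h0, sub_sub_cancel]; ring
    rw [h1, abs_neg]
    have h2 := hN N le_rfl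
    rw [dist_eq_norm] at h2
    calc _ ≤ ‖h‖ * ‖((K N)ᗮ).starProjection x - V.starProjection x‖ := abs_real_inner_le_norm _ _
      _ ≤ ‖h‖ * ε := by gcongr
      _ = _ := mul_comm _ _

/-- If a function agrees almost everywhere with an `F n`-measurable function for every `n`, then it
agrees almost everywhere with a function measurable for the intersection of the `F n`. -/
theorem exists_measurable_iInf_ae_eq {Ω : Type*} {m0 : MeasurableSpace Ω} {μ : Measure Ω}
    (F : ℕ → MeasurableSpace Ω) (hF : Antitone F) (y : Ω → ℝ) (yn : ℕ → Ω → ℝ)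
    (hm : ∀ n, Measurable[F n] (yn n)) (hy : ∀ n, y =ᵐ[μ] yn n) :
    ∃ g : Ω → ℝ, Measurable[⨅ n, F n] g ∧ y =ᵐ[μ] g := by
  refine ⟨fun x => limsup (fun n => yn n x) atTop, ?_, ?_⟩
  · intro s hs
    rw [MeasurableSpace.measurableSet_iInf]
    intro k
    have h1 : (fun x => limsup (fun n => yn n x) atTop)
        = fun x => limsup (fun n => yn (n + k) x) atTop := by
      funext x
      exact (Filter.limsup_nat_add (fun n => yn n x) k).symm
    rw [h1]
    have h2 : Measurable[F k] fun x => limsup (fun n => yn (n + k) x) atTop :=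
      Measurable.limsup fun n => (hm (n + k)).mono (hF (Nat.le_add_left k n)) le_rfl
    exact h2 hs
  · filter_upwards [ae_all_iff.2 hy] with x hx
    simp [← hx]

/-- A bounded function is asymptotically indistinguishable from some `⨅ n, F n`-measurable one when
tested against `F n`-measurable functions (reverse martingale convergence). -/
theorem exists_measurable_iInf_integral_mul_sub_le {Ω : Type*} {m0 : MeasurableSpace Ω}
    (μ : Measure Ω) [IsProbabilityMeasure μ]
    (F : ℕ → MeasurableSpace Ω) (hF : Antitone F) (hF0 : ∀ n, F n ≤ m0)
    (f : Ω → ℝ) (hf : Measurable f) (hf1 : ∀ x, |f x| ≤ 1) :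
    ∃ g : Ω → ℝ, Measurable[⨅ n, F n] g ∧ (∀ x, |g x| ≤ 1) ∧
      ∀ ε > 0, ∃ N, ∀ h : Ω → ℝ, Measurable[F N] h → (∀ x, |h x| ≤ 1) →
        |∫ x, h x * (f x - g x) ∂μ| ≤ ε := by
  have bmem : ∀ h : Ω → ℝ, Measurable h → (∀ x, |h x| ≤ 1) → MemLp h 2 μ := fun h hh h1 =>
    MemLp.of_bound hh.aestronglyMeasurable 1 (ae_of_all _ h1)
  have hfL := bmem f hf hf1
  obtain ⟨y, hyK, hy⟩ := exists_mem_iInf_inner_sub_le (fun n => lpMeas ℝ ℝ (F n) 2 μ)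
    (fun a b hab u hu => by
      rw [mem_lpMeas_iff_aestronglyMeasurable] at hu ⊢
      exact hu.mono (hF hab))
    (fun n => isClosed_aestronglyMeasurable (hF0 n)) (hfL.toLp f)
  have key : ∀ ε > 0, ∃ N, ∀ h : Ω → ℝ, Measurable[F N] h → (∀ x, |h x| ≤ 1) →
        |∫ x, h x * (f x - y x) ∂μ| ≤ ε := by
    intro ε hε
    obtain ⟨N, hN⟩ := hy ε hε
    refine ⟨N, fun h hh h1 => ?_⟩
    have hhL := bmem h (hh.mono (hF0 N) le_rfl) h1
    have h2 := hN (hhL.toLp h) (by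
      rw [mem_lpMeas_iff_aestronglyMeasurable]
      exact ⟨h, hh.stronglyMeasurable, hhL.coeFn_toLp⟩)
    have h3 : ‖hhL.toLp h‖ ≤ 1 := by
      refine (Lp.norm_le_of_ae_bound (C := 1) zero_le_one ?_).trans (by simp [measureUnivNNReal])
      filter_upwards [hhL.coeFn_toLp] with x hx
      rw [hx]; exact h1 x
    have h4 : ⟪hhL.toLp h, hfL.toLp f - y⟫_ℝ = ∫ x, h x * (f x - y x) ∂μ := by
      rw [L2.inner_def]
      refine integral_congr_ae ?_
      filter_upwards [hhL.coeFn_toLp, hfL.coeFn_toLp, Lp.coeFn_sub (hfL.toLp f) y] with x a b c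
      rw [a, c]
      simp [b, mul_comm]
    rw [h4] at h2
    nlinarith
  have hy1 : ∀ n, AEStronglyMeasurable[F n] y μ := fun n =>
    mem_lpMeas_iff_aestronglyMeasurable.1 (hyK n)
  obtain ⟨g0, hg0, hyg0⟩ := exists_measurable_iInf_ae_eq (μ := μ) F hF y (fun n => (hy1 n).mk y)
    (fun n => (hy1 n).stronglyMeasurable_mk.measurable) (fun n => (hy1 n).ae_eq_mk)
  have hinf : (⨅ n, F n) ≤ m0 := (iInf_le F 0).trans (hF0 0)
  have hyint : Integrable y μ := (Lp.memLp y).integrable (by norm_num)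
  have hfint : Integrable f μ := hfL.integrable (by norm_num)
  have hgc : g0 =ᵐ[μ] μ[f | ⨅ n, F n] := by
    refine ae_eq_condExp_of_forall_setIntegral_eq hinf hfint
      (fun s _ _ => (hyint.congr hyg0).integrableOn) (fun s hs _ => ?_)
      hg0.stronglyMeasurable.aestronglyMeasurable
    have hs0 : MeasurableSet[m0] s := hinf s hs
    rw [← sub_eq_zero, ← abs_eq_zero]
    refine le_antisymm (le_of_forall_pos_le_add fun ε hε => ?_) (abs_nonneg _)
    obtain ⟨N, hN⟩ := key ε hε
    have h1 := hN (s.indicator fun _ => 1)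
      (measurable_const.indicator (MeasurableSpace.measurableSet_iInf.1 hs N))
      (fun x => by by_cases hx : x ∈ s <;> simp [hx])
    have h2 : ∫ x, s.indicator (fun _ => (1 : ℝ)) x * (f x - y x) ∂μ
        = ∫ x in s, f x ∂μ - ∫ x in s, g0 x ∂μ := by
      rw [← integral_sub hfint.integrableOn (hyint.congr hyg0).integrableOn,
        ← integral_indicator hs0]
      refine integral_congr_ae ?_
      filter_upwards [hyg0] with x hx
      by_cases hxs : x ∈ s <;> simp [hxs, hx]
    rw [h2, abs_sub_comm] at h1
    simpa using h1
  have hb : ∀ᵐ x ∂μ, |(μ[f | ⨅ n, F n]) x| ≤ 1 :=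
    ae_bdd_abs_condExp_of_ae_bdd_abs (ae_of_all _ hf1)
  refine ⟨fun x => max (-1) (min 1 (g0 x)), measurable_const.max (measurable_const.min hg0),
    fun x => abs_le.2 ⟨le_max_left _ _, max_le (by norm_num) (min_le_left _ _)⟩, fun ε hε => ?_⟩
  obtain ⟨N, hN⟩ := key ε hε
  refine ⟨N, fun h hh h1 => ?_⟩
  convert hN h hh h1 using 2
  refine integral_congr_ae ?_
  filter_upwards [hyg0, hgc, hb] with x a b c
  rw [← b] at c
  have := abs_le.1 c
  rw [a, min_eq_right this.2, max_eq_right this.1]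

/-- The σ-algebra `σ(ξ_i : i ≤ p)` of the past up to time `p`. -/
@[reducible]
def pastAlg (A : Type*) [MeasurableSpace A] (p : ℤ) : MeasurableSpace (ℤ → A) :=
  ⨆ i : ℤ, ⨆ _ : i ≤ p, MeasurableSpace.comap (fun x : ℤ → A => x i) inferInstance

theorem shiftZ_shiftZ {A : Type*} (m n : ℤ) (x : ℤ → A) : shiftZ A m (shiftZ A n x) = shiftZ A (m + n) x := by
  funext i; simp [shiftZ, add_assoc]

theorem shiftZ_zero {A : Type*} (x : ℤ → A) : shiftZ A 0 x = x := by
  funext i; simp [shiftZ]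

theorem window_shiftZ {A : Type*} (ℓ : ℕ) (p n : ℤ) (x : ℤ → A) :
    window ℓ p (shiftZ A n x) = window ℓ (p + n) x := by
  funext i; simp only [window, shiftZ]; congr 1; ring

theorem abs_mul_le_one {a b : ℝ} (ha : |a| ≤ 1) (hb : |b| ≤ 1) : |a * b| ≤ 1 := by
  rw [abs_mul]; exact mul_le_one₀ ha (abs_nonneg _) hb

theorem integrable_of_abs_le_one {Ω : Type*} {m : MeasurableSpace Ω} {μ : Measure Ω}
    [IsFiniteMeasure μ] {f : Ω → ℝ} (hf : Measurable f) (h : ∀ x, |f x| ≤ 1) : Integrable f μ :=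
  Integrable.of_bound hf.aestronglyMeasurable 1 (ae_of_all _ h)

section Past

variable {A : Type*} [MeasurableSpace A]

theorem pastAlg_mono : Monotone (pastAlg A) := fun _ _ h =>
  iSup₂_le fun i hi => le_iSup₂_of_le i (hi.trans h) le_rfl

theorem pastAlg_le_pi (p : ℤ) : pastAlg A p ≤ MeasurableSpace.pi :=
  iSup₂_le fun i _ => le_iSup (fun i : ℤ =>
    MeasurableSpace.comap (fun x : ℤ → A => x i) inferInstance) i

theorem measurable_eval_pastAlg {i p : ℤ} (h : i ≤ p) :
    Measurable[pastAlg A p] fun x : ℤ → A => x i :=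
  measurable_iff_comap_le.2 (le_iSup₂_of_le i h le_rfl)

theorem measurable_shiftZ_pastAlg {n p r : ℤ} (h : p + n ≤ r) :
    Measurable[pastAlg A r, pastAlg A p] (shiftZ A n) := by
  rw [measurable_iff_comap_le, pastAlg]
  simp only [MeasurableSpace.comap_iSup, MeasurableSpace.comap_comp]
  exact iSup₂_le fun i hi => measurable_iff_comap_le.1 (measurable_eval_pastAlg (by omega))

theorem measurable_window_pastAlg {ℓ : ℕ} {p r : ℤ} (h : p + ℓ ≤ r) :
    Measurable[pastAlg A r] (window (A := A) ℓ p) :=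
  @measurable_pi_lambda _ _ _ (pastAlg A r) _ _ fun i =>
    measurable_eval_pastAlg (by have := i.2; omega)

theorem pinskerAlg_le_pastAlg (p : ℤ) : pinskerAlg A ≤ pastAlg A p := iInf_le _ p

theorem measurable_shiftZ_pinskerAlg (n : ℤ) :
    Measurable[pinskerAlg A, pinskerAlg A] (shiftZ A n) := by
  intro s hs
  refine (MeasurableSpace.measurableSet_iInf).2 fun p => ?_
  exact measurable_shiftZ_pastAlg (p := p - n) (by omega) (pinskerAlg_le_pastAlg _ s hs)

theorem iInf_pastAlg_neg_le : ⨅ n : ℕ, pastAlg A (-(n : ℤ)) ≤ pinskerAlg A :=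
  le_iInf fun p => (iInf_le _ (-p).toNat).trans (pastAlg_mono (by omega))

theorem measurable_shiftZ (n : ℤ) : Measurable (shiftZ A n) :=
  measurable_pi_lambda _ fun i => measurable_pi_apply (i + n)

theorem measurePreserving_shiftZ {μ : Measure (ℤ → A)} (h : μ.map (shiftT A) = μ) (n : ℤ) :
    MeasurePreserving (shiftZ A n) μ μ := by
  have h1 : MeasurePreserving (shiftZ A 1) μ μ := ⟨measurable_shiftZ 1, h⟩
  have hN : ∀ n : ℕ, MeasurePreserving (shiftZ A n) μ μ := by
    intro n
    induction n with
    | zero =>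
      have : shiftZ A ((0 : ℕ) : ℤ) = id := funext fun x => shiftZ_zero x
      rw [this]
      exact MeasurePreserving.id μ
    | succ n ih =>
      have : shiftZ A ((n + 1 : ℕ) : ℤ) = shiftZ A n ∘ shiftZ A 1 :=
        funext fun x => by simp [shiftZ_shiftZ]
      rw [this]
      exact ih.comp h1
  obtain ⟨m, rfl | rfl⟩ := n.eq_nat_or_neg
  · exact hN m
  · let e : (ℤ → A) ≃ᵐ (ℤ → A) :=
      { toFun := shiftZ A m
        invFun := shiftZ A (-m)
        left_inv := fun x => by simp [shiftZ_shiftZ, shiftZ_zero]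
        right_inv := fun x => by simp [shiftZ_shiftZ, shiftZ_zero]
        measurable_toFun := measurable_shiftZ _
        measurable_invFun := measurable_shiftZ _ }
    exact MeasurePreserving.symm e (hN m)

theorem integral_comp_shiftZ {μ : Measure (ℤ → A)} (h : μ.map (shiftT A) = μ) (n : ℤ)
    {f : (ℤ → A) → ℝ} (hf : Measurable f) : ∫ x, f (shiftZ A n x) ∂μ = ∫ x, f x ∂μ := by
  have hmp := measurePreserving_shiftZ h n
  conv_rhs => rw [← hmp.map_eq]
  exact (integral_map hmp.measurable.aemeasurable hf.aestronglyMeasurable).symm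

/-- The triple correlation `∫ f₁ · f₂ ∘ Tᵃ · f₃ ∘ Tᵇ dμ`. -/
noncomputable def tripleCorr (μ : Measure (ℤ → A)) (f₁ f₂ f₃ : (ℤ → A) → ℝ) (a b : ℤ) : ℝ :=
  ∫ x, f₁ x * f₂ (shiftZ A a x) * f₃ (shiftZ A b x) ∂μ

/-- `g` is a bounded `Π`-measurable function which cannot be distinguished from `f` by bounded
functions depending on the remote past only. -/
def IsTailProj (μ : Measure (ℤ → A)) (f g : (ℤ → A) → ℝ) : Prop :=
  Measurable[pinskerAlg A] g ∧ (∀ x, |g x| ≤ 1) ∧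
    ∀ ε > 0, ∃ N : ℕ, ∀ h : (ℤ → A) → ℝ, Measurable[pastAlg A (-N)] h → (∀ x, |h x| ≤ 1) →
      |∫ x, h x * (f x - g x) ∂μ| ≤ ε

theorem exists_isTailProj (μ : Measure (ℤ → A)) [IsProbabilityMeasure μ] {f : (ℤ → A) → ℝ}
    (hf : Measurable f) (hf1 : ∀ x, |f x| ≤ 1) : ∃ g, IsTailProj μ f g := by
  obtain ⟨g, hg, hg1, h⟩ := exists_measurable_iInf_integral_mul_sub_le μ
    (fun n : ℕ => pastAlg A (-n)) (fun a b hab => pastAlg_mono (by omega))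
    (fun n => pastAlg_le_pi _) f hf hf1
  exact ⟨g, hg.mono iInf_pastAlg_neg_le le_rfl, hg1, h⟩

theorem IsTailProj.integral_eq {μ : Measure (ℤ → A)} [IsProbabilityMeasure μ]
    {f g : (ℤ → A) → ℝ} (hfg : IsTailProj μ f g) (hf : Measurable f) (hf1 : ∀ x, |f x| ≤ 1) :
    ∫ x, f x ∂μ = ∫ x, g x ∂μ := by
  obtain ⟨hg, hg1, h⟩ := hfg
  have hg' := hg.mono ((pinskerAlg_le_pastAlg 0).trans (pastAlg_le_pi _)) le_rfl
  rw [← sub_eq_zero, ← abs_eq_zero]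
  refine le_antisymm (le_of_forall_pos_le_add fun ε hε => ?_) (abs_nonneg _)
  obtain ⟨N, hN⟩ := h ε hε
  have := hN (fun _ => 1) measurable_const (by simp)
  simp only [one_mul] at this
  rw [integral_sub (integrable_of_abs_le_one hf hf1) (integrable_of_abs_le_one hg' hg1)] at this
  simpa using this

theorem tripleCorr_sub_tailProj_le {μ : Measure (ℤ → A)} [IsProbabilityMeasure μ]
    (hstat : μ.map (shiftT A) = μ) (ℓ : ℕ) {f₁ f₂ f₃ g₁ g₂ g₃ : (ℤ → A) → ℝ}
    (hf₁ : Measurable[pastAlg A ℓ] f₁) (hf₂ : Measurable[pastAlg A ℓ] f₂)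
    (hf₃ : Measurable[pastAlg A ℓ] f₃) (b₁ : ∀ x, |f₁ x| ≤ 1) (b₂ : ∀ x, |f₂ x| ≤ 1)
    (b₃ : ∀ x, |f₃ x| ≤ 1) (h₁ : IsTailProj μ f₁ g₁) (h₂ : IsTailProj μ f₂ g₂)
    (h₃ : IsTailProj μ f₃ g₃) {ε : ℝ} (hε : 0 < ε) :
    ∃ N : ℕ, ∀ p ≥ N, ∀ q ≥ N, |tripleCorr μ f₁ f₂ f₃ p (p + q : ℤ)
      - tripleCorr μ g₁ g₂ g₃ p (p + q : ℤ)| ≤ 3 * ε := by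
  obtain ⟨m₁, c₁, h₁⟩ := h₁
  obtain ⟨m₂, c₂, h₂⟩ := h₂
  obtain ⟨m₃, c₃, h₃⟩ := h₃
  obtain ⟨N₁, h₁⟩ := h₁ ε hε
  obtain ⟨N₂, h₂⟩ := h₂ ε hε
  obtain ⟨N₃, h₃⟩ := h₃ ε hε
  have pin : ∀ {u : (ℤ → A) → ℝ} (n r : ℤ), Measurable[pinskerAlg A] u →
      Measurable[pastAlg A r] fun x => u (shiftZ A n x) := fun n r hu =>
    (hu.comp (measurable_shiftZ_pinskerAlg n)).mono (pinskerAlg_le_pastAlg r) le_rfl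
  have full : ∀ {u : (ℤ → A) → ℝ} {r : ℤ}, Measurable[pastAlg A r] u → Measurable u :=
    fun hu => hu.mono (pastAlg_le_pi _) le_rfl
  have F₁ := full hf₁
  have F₂ := full hf₂
  have F₃ := full hf₃
  have G₁ := full (m₁.mono (pinskerAlg_le_pastAlg 0) le_rfl)
  have G₂ := full (m₂.mono (pinskerAlg_le_pastAlg 0) le_rfl)
  have G₃ := full (m₃.mono (pinskerAlg_le_pastAlg 0) le_rfl)
  have S := fun n : ℤ => measurable_shiftZ (A := A) n
  have int : ∀ {u v w : (ℤ → A) → ℝ} (a b : ℤ), Measurable u → Measurable v → Measurable w →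
      (∀ x, |u x| ≤ 1) → (∀ x, |v x| ≤ 1) → (∀ x, |w x| ≤ 1) →
      Integrable (fun x => u x * v (shiftZ A a x) * w (shiftZ A b x)) μ :=
    fun a b hu hv hw bu bv bw => integrable_of_abs_le_one
      ((hu.mul (hv.comp (S a))).mul (hw.comp (S b)))
      fun x => abs_mul_le_one (abs_mul_le_one (bu _) (bv _)) (bw _)
  refine ⟨N₁ + N₂ + N₃ + ℓ, fun p hp q hq => ?_⟩
  have e₃ : |tripleCorr μ f₁ f₂ f₃ p (p + q : ℤ) - tripleCorr μ f₁ f₂ g₃ p (p + q : ℤ)| ≤ ε := by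
    have := h₃ (fun x => f₁ (shiftZ A (-(p + q)) x) * f₂ (shiftZ A (-q) x))
      (Measurable.mul (hf₁.comp (measurable_shiftZ_pastAlg (by omega)))
        (hf₂.comp (measurable_shiftZ_pastAlg (by omega))))
      (fun x => abs_mul_le_one (b₁ _) (b₂ _))
    rw [← integral_comp_shiftZ hstat (p + q) (by fun_prop)] at this
    unfold tripleCorr
    rw [← integral_sub (int _ _ F₁ F₂ F₃ b₁ b₂ b₃) (int _ _ F₁ F₂ G₃ b₁ b₂ c₃)]
    simpa [shiftZ_shiftZ, shiftZ_zero, mul_sub] using this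
  have e₂ : |tripleCorr μ f₁ f₂ g₃ p (p + q : ℤ) - tripleCorr μ f₁ g₂ g₃ p (p + q : ℤ)| ≤ ε := by
    have := h₂ (fun x => f₁ (shiftZ A (-p) x) * g₃ (shiftZ A q x))
      (Measurable.mul (hf₁.comp (measurable_shiftZ_pastAlg (by omega))) (pin _ _ m₃))
      (fun x => abs_mul_le_one (b₁ _) (c₃ _))
    rw [← integral_comp_shiftZ hstat p (by fun_prop)] at this
    unfold tripleCorr
    rw [← integral_sub (int _ _ F₁ F₂ G₃ b₁ b₂ c₃) (int _ _ F₁ G₂ G₃ b₁ c₂ c₃)]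
    convert this using 3
    funext x
    simp only [shiftZ_shiftZ, neg_add_cancel, shiftZ_zero, add_comm (q : ℤ)]
    ring
  have e₁ : |tripleCorr μ f₁ g₂ g₃ p (p + q : ℤ) - tripleCorr μ g₁ g₂ g₃ p (p + q : ℤ)| ≤ ε := by
    have := h₁ (fun x => g₂ (shiftZ A p x) * g₃ (shiftZ A (p + q) x))
      (Measurable.mul (pin _ _ m₂) (pin _ _ m₃))
      (fun x => abs_mul_le_one (c₂ _) (c₃ _))
    unfold tripleCorr
    rw [← integral_sub (int _ _ F₁ G₂ G₃ b₁ c₂ c₃) (int _ _ G₁ G₂ G₃ c₁ c₂ c₃)]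
    convert this using 3
    funext x
    ring
  rw [abs_le] at *
  constructor <;> linarith [e₁.1, e₁.2, e₂.1, e₂.2, e₃.1, e₃.2]

end Past

theorem abs_mul_mul_sub_le {a b c a' b' c' : ℝ} (hb : |b| ≤ 1) (hc : |c| ≤ 1)
    (ha' : |a'| ≤ 1) (hb' : |b'| ≤ 1) :
    |a * b * c - a' * b' * c'| ≤ |a - a'| + |b - b'| + |c - c'| := by
  have e : a * b * c - a' * b' * c'
      = (a - a') * (b * c) + (b - b') * (a' * c) + (c - c') * (a' * b') := by ring
  have h : ∀ {u v : ℝ}, |v| ≤ 1 → |u * v| ≤ |u| := fun {u v} hv => by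
    rw [abs_mul]; exact mul_le_of_le_one_right (abs_nonneg u) hv
  rw [e]
  exact (abs_add_three _ _ _).trans (add_le_add_three (h (abs_mul_le_one hb hc))
    (h (abs_mul_le_one ha' hc)) (h (abs_mul_le_one ha' hb')))

theorem measurable_window {A : Type*} [MeasurableSpace A] (ℓ : ℕ) (p : ℤ) :
    Measurable (window (A := A) ℓ p) :=
  measurable_pi_lambda _ fun _ => measurable_pi_apply _

/-- Mixing of order three for functions of a window. -/
theorem Mixing3.tendsto_integral {B : Type*} [Fintype B] [MeasurableSpace B]
    [DiscreteMeasurableSpace B] {ν : Measure (ℤ → B)} [IsFiniteMeasure ν] (h : Mixing3 ν) (ℓ : ℕ)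
    (k₁ k₂ k₃ : (Fin (ℓ + 1) → B) → ℝ) :
    Tendsto (fun pq : ℕ × ℕ => ∫ y, k₁ (window ℓ 0 y) * k₂ (window ℓ pq.1 y) *
        k₃ (window ℓ ((pq.1 : ℤ) + pq.2) y) ∂ν) (atTop ×ˢ atTop)
      (nhds ((∫ y, k₁ (window ℓ 0 y) ∂ν) * (∫ y, k₂ (window ℓ 0 y) ∂ν) *
        ∫ y, k₃ (window ℓ 0 y) ∂ν)) := by
  classical
  have hw : ∀ (p : ℤ) (a : Fin (ℓ + 1) → B), MeasurableSet {y | window ℓ p y = a} := fun p a =>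
    measurable_window ℓ p (measurableSet_singleton a)
  have single : ∀ k : (Fin (ℓ + 1) → B) → ℝ,
      ∫ y, k (window ℓ 0 y) ∂ν = ∑ a, k a * (ν {y | window ℓ 0 y ∈ ({a} : Set _)}).toReal := by
    intro k
    have e : ∀ y, k (window ℓ 0 y)
        = ∑ a, k a * Set.indicator {y | window ℓ 0 y = a} (fun _ => (1 : ℝ)) y := fun y => by
      simp [Set.indicator_apply]
    simp_rw [e]
    rw [integral_finsetSum _ fun a _ => ((integrable_const _).indicator (hw 0 a)).const_mul _]
    refine Finset.sum_congr rfl fun a _ => ?_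
    rw [integral_const_mul, integral_indicator_const _ (hw 0 a)]
    simp [Measure.real]
  have triple : ∀ p r : ℤ, ∫ y, k₁ (window ℓ 0 y) * k₂ (window ℓ p y) * k₃ (window ℓ r y) ∂ν
      = ∑ a, ∑ b, ∑ c, k₁ a * k₂ b * k₃ c * (ν {y | window ℓ 0 y ∈ ({a} : Set _) ∧
          window ℓ p y ∈ ({b} : Set _) ∧ window ℓ r y ∈ ({c} : Set _)}).toReal := by
    intro p r
    have hm : ∀ a b c, MeasurableSet {y : ℤ → B | window ℓ 0 y = a ∧ window ℓ p y = b ∧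
        window ℓ r y = c} := fun a b c => (hw 0 a).inter ((hw p b).inter (hw r c))
    have e : ∀ y, k₁ (window ℓ 0 y) * k₂ (window ℓ p y) * k₃ (window ℓ r y)
        = ∑ a, ∑ b, ∑ c, k₁ a * k₂ b * k₃ c * Set.indicator {y | window ℓ 0 y = a ∧
          window ℓ p y = b ∧ window ℓ r y = c} (fun _ => (1 : ℝ)) y := fun y => by
      simp [Set.indicator_apply, ite_and]
    simp_rw [e]
    have hi : ∀ a b c, Integrable (fun y => k₁ a * k₂ b * k₃ c * Set.indicator
        {y | window ℓ 0 y = a ∧ window ℓ p y = b ∧ window ℓ r y = c} (fun _ => (1 : ℝ)) y) ν :=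
      fun a b c => ((integrable_const _).indicator (hm a b c)).const_mul _
    rw [integral_finsetSum _ fun a _ => integrable_finsetSum _ fun b _ =>
      integrable_finsetSum _ fun c _ => hi a b c]
    refine Finset.sum_congr rfl fun a _ => ?_
    rw [integral_finsetSum _ fun b _ => integrable_finsetSum _ fun c _ => hi a b c]
    refine Finset.sum_congr rfl fun b _ => ?_
    rw [integral_finsetSum _ fun c _ => hi a b c]
    refine Finset.sum_congr rfl fun c _ => ?_
    rw [integral_const_mul, integral_indicator_const _ (hm a b c)]
    simp [Measure.real]
  simp_rw [triple, single]
  rw [Finset.sum_mul_sum]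
  simp_rw [Finset.sum_mul, Finset.mul_sum]
  refine tendsto_finsetSum _ fun a _ => tendsto_finsetSum _ fun b _ =>
    tendsto_finsetSum _ fun c _ => ?_
  have := ((h ℓ {a} {b} {c}).add_const ((ν {y | window ℓ 0 y ∈ ({a} : Set _)}).toReal *
    (ν {y | window ℓ 0 y ∈ ({b} : Set _)}).toReal *
    (ν {y | window ℓ 0 y ∈ ({c} : Set _)}).toReal)).const_mul (k₁ a * k₂ b * k₃ c)
  simp only [sub_add_cancel, zero_add] at this
  convert this using 2
  ring

section Factor

variable {A B : Type*} [MeasurableSpace A] [MeasurableSpace B]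

/-- The map `x ↦ (ζ_i x)_{i ∈ ℤ}` of a process to its factor. -/
abbrev factorMap {A B : Type*} (ζ0 : (ℤ → A) → B) : (ℤ → A) → (ℤ → B) :=
  fun x i => ζ0 (shiftZ A i x)

theorem factorMap_shiftZ {A B : Type*} (ζ0 : (ℤ → A) → B) (n : ℤ) (x : ℤ → A) :
    factorMap ζ0 (shiftZ A n x) = shiftZ B n (factorMap ζ0 x) := by
  funext i; simp [factorMap, shiftZ_shiftZ, shiftZ]

theorem measurable_factorMap_pinskerAlg {ζ0 : (ℤ → A) → B} (hζ0 : Measurable[pinskerAlg A] ζ0) :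
    Measurable[pinskerAlg A] (factorMap ζ0) :=
  @measurable_pi_lambda _ _ _ (pinskerAlg A) _ _ fun i =>
    hζ0.comp (measurable_shiftZ_pinskerAlg i)

theorem pinskerAlg_le_pi : pinskerAlg A ≤ MeasurableSpace.pi :=
  (pinskerAlg_le_pastAlg 0).trans (pastAlg_le_pi 0)

/-- The filtration of the σ-algebras `σ(ζ_{-m}, …, ζ_m)`. -/
def factorFiltration {ζ0 : (ℤ → A) → B} (hζ0 : Measurable[pinskerAlg A] ζ0) :
    Filtration ℕ (MeasurableSpace.pi : MeasurableSpace (ℤ → A)) where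
  seq m := MeasurableSpace.comap (fun x => window (2 * m) (-m) (factorMap ζ0 x)) inferInstance
  mono' m n hmn := by
    rw [← measurable_iff_comap_le]
    refine @measurable_pi_lambda _ _ _ (_) _ _ fun i => ?_
    have hi := i.2
    have h1 : (fun x => window (2 * m) (-m) (factorMap ζ0 x) i)
        = (fun w : Fin (2 * n + 1) → B => w ⟨n - m + i, by omega⟩) ∘
          fun x => window (2 * n) (-n) (factorMap ζ0 x) := by
      funext x
      simp only [window, Function.comp]
      refine congrArg (factorMap ζ0 x) ?_
      push_cast [Nat.cast_sub hmn]
      ring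
    rw [h1]
    exact (measurable_pi_apply _).comp (comap_measurable _)
  le' m := by
    rw [← measurable_iff_comap_le]
    exact (measurable_window _ _).comp
      ((measurable_factorMap_pinskerAlg hζ0).mono pinskerAlg_le_pi le_rfl)

theorem iSup_factorFiltration_le {ζ0 : (ℤ → A) → B} (hζ0 : Measurable[pinskerAlg A] ζ0) :
    ⨆ m, factorFiltration hζ0 m ≤ pinskerAlg A :=
  iSup_le fun _ => measurable_iff_comap_le.1
    ((measurable_window _ _).comp (measurable_factorMap_pinskerAlg hζ0))

theorem factorAlg_le_iSup {ζ0 : (ℤ → A) → B} (hζ0 : Measurable[pinskerAlg A] ζ0) :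
    factorAlg A ζ0 ≤ ⨆ m, factorFiltration hζ0 m := by
  refine iSup_le fun i => le_iSup_of_le i.natAbs ?_
  rw [← measurable_iff_comap_le]
  have h1 : (fun x => ζ0 (shiftZ A i x))
      = (fun w : Fin (2 * i.natAbs + 1) → B => w ⟨(i + i.natAbs).toNat, by omega⟩) ∘
        fun x => window (2 * i.natAbs) (-i.natAbs) (factorMap ζ0 x) := by
    funext x
    simp only [window, Function.comp, factorMap]
    congr 2
    omega
  rw [h1]
  exact (measurable_pi_apply _).comp (comap_measurable _)

/-- If `m` is a sub-σ-algebra of `m'` which equals it modulo null sets, then conditioning on `m`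
does not change `m'`-measurable functions. -/
theorem condExp_ae_eq_of_ae_le {Ω : Type*} {m m' m0 : MeasurableSpace Ω} {μ : Measure[m0] Ω}
    [IsFiniteMeasure μ] (hm : m ≤ m') (hm' : m' ≤ m0)
    (h : ∀ s, MeasurableSet[m'] s → ∃ t, MeasurableSet[m] t ∧ μ (s ∆ t) = 0)
    {g : Ω → ℝ} (hg : Measurable[m'] g) (hgi : Integrable g μ) : μ[g | m] =ᵐ[μ] g := by
  have h1 : μ[g | m] =ᵐ[μ] μ[g | m'] := by
    refine ae_eq_condExp_of_forall_setIntegral_eq hm' hgi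
      (fun s _ _ => integrable_condExp.integrableOn) (fun s hs _ => ?_)
      (stronglyMeasurable_condExp.mono hm).aestronglyMeasurable
    obtain ⟨t, ht, hst⟩ := h s hs
    have e : s =ᵐ[μ] t := measure_symmDiff_eq_zero_iff.1 hst
    rw [setIntegral_congr_set e, setIntegral_congr_set e, setIntegral_condExp (hm.trans hm') hgi ht]
  rwa [condExp_of_stronglyMeasurable hm' hg.stronglyMeasurable hgi] at h1

theorem exists_window_approx {μ : Measure (ℤ → A)} [IsProbabilityMeasure μ] {ζ0 : (ℤ → A) → B}
    (hζ0 : Measurable[pinskerAlg A] ζ0)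
    (h : ∀ s : Set (ℤ → A), MeasurableSet[pinskerAlg A] s →
      ∃ t : Set (ℤ → A), MeasurableSet[factorAlg A ζ0] t ∧ μ (s ∆ t) = 0)
    {g : (ℤ → A) → ℝ} (hg : Measurable[pinskerAlg A] g) (hg1 : ∀ x, |g x| ≤ 1)
    {ε : ℝ} (hε : 0 < ε) :
    ∃ M : ℕ, ∀ m ≥ M, ∃ k : (Fin (2 * m + 1) → B) → ℝ, Measurable k ∧ (∀ w, |k w| ≤ 1) ∧
      ∫ x, |g x - k (window (2 * m) (-m) (factorMap ζ0 x))| ∂μ ≤ ε := by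
  have hgi := integrable_of_abs_le_one (μ := μ) (hg.mono pinskerAlg_le_pi le_rfl) hg1
  have hce : μ[g | ⨆ m, factorFiltration hζ0 m] =ᵐ[μ] g :=
    condExp_ae_eq_of_ae_le (iSup_factorFiltration_le hζ0) pinskerAlg_le_pi (fun s hs =>
      let ⟨t, ht, hst⟩ := h s hs
      ⟨t, factorAlg_le_iSup hζ0 t ht, hst⟩) hg hgi
  have hlim := tendsto_eLpNorm_condExp (ℱ := factorFiltration hζ0) (μ := μ) g
  obtain ⟨M, hM⟩ := eventually_atTop.1
    ((ENNReal.tendsto_nhds_zero.1 hlim) (ENNReal.ofReal ε) (by simpa using hε))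
  refine ⟨M, fun m hm => ?_⟩
  have hsm : StronglyMeasurable[factorFiltration hζ0 m] (μ[g | factorFiltration hζ0 m]) :=
    stronglyMeasurable_condExp
  obtain ⟨k, hk, hkeq⟩ := hsm.measurable.exists_eq_measurable_comp
  have hb : ∀ᵐ x ∂μ, |(μ[g | factorFiltration hζ0 m]) x| ≤ 1 :=
    ae_bdd_abs_condExp_of_ae_bdd_abs (ae_of_all _ hg1)
  refine ⟨fun w => max (-1) (min 1 (k w)), measurable_const.max (measurable_const.min hk),
    fun w => abs_le.2 ⟨le_max_left _ _, max_le (by norm_num) (min_le_left _ _)⟩, ?_⟩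
  have e : ∫ x, |g x - max (-1) (min 1 (k (window (2 * m) (-m) (factorMap ζ0 x))))| ∂μ
      = ∫ x, ‖(μ[g | factorFiltration hζ0 m] - μ[g | ⨆ m, factorFiltration hζ0 m]) x‖ ∂μ := by
    refine integral_congr_ae ?_
    filter_upwards [hb, hce] with x hx hx'
    have hkx : (μ[g | factorFiltration hζ0 m]) x
        = k (window (2 * m) (-m) (factorMap ζ0 x)) := congrFun hkeq x
    rw [Pi.sub_apply, hx', Real.norm_eq_abs, abs_sub_comm]
    rw [hkx] at hx ⊢
    rw [min_eq_right (abs_le.1 hx).2, max_eq_right (abs_le.1 hx).1]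
  rw [e, integral_norm_eq_lintegral_enorm
    (integrable_condExp.sub integrable_condExp).aestronglyMeasurable, ← eLpNorm_one_eq_lintegral_enorm]
  exact ENNReal.toReal_le_of_le_ofReal hε.le (hM m hm)

theorem tripleCorr_sub_le {μ : Measure (ℤ → A)} [IsProbabilityMeasure μ]
    (hstat : μ.map (shiftT A) = μ) {g₁ g₂ g₃ k₁ k₂ k₃ : (ℤ → A) → ℝ}
    (G₁ : Measurable g₁) (G₂ : Measurable g₂) (G₃ : Measurable g₃)
    (K₁ : Measurable k₁) (K₂ : Measurable k₂) (K₃ : Measurable k₃)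
    (c₁ : ∀ x, |g₁ x| ≤ 1) (c₂ : ∀ x, |g₂ x| ≤ 1) (c₃ : ∀ x, |g₃ x| ≤ 1)
    (d₁ : ∀ x, |k₁ x| ≤ 1) (d₂ : ∀ x, |k₂ x| ≤ 1) (d₃ : ∀ x, |k₃ x| ≤ 1) (a b : ℤ) :
    |tripleCorr μ g₁ g₂ g₃ a b - tripleCorr μ k₁ k₂ k₃ a b| ≤
      ∫ x, |g₁ x - k₁ x| ∂μ + ∫ x, |g₂ x - k₂ x| ∂μ + ∫ x, |g₃ x - k₃ x| ∂μ := by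
  have S := fun n : ℤ => measurable_shiftZ (A := A) n
  have int : ∀ {u v w : (ℤ → A) → ℝ}, Measurable u → Measurable v → Measurable w →
      (∀ x, |u x| ≤ 1) → (∀ x, |v x| ≤ 1) → (∀ x, |w x| ≤ 1) →
      Integrable (fun x => u x * v (shiftZ A a x) * w (shiftZ A b x)) μ :=
    fun hu hv hw bu bv bw => integrable_of_abs_le_one
      ((hu.mul (hv.comp (S a))).mul (hw.comp (S b)))
      fun x => abs_mul_le_one (abs_mul_le_one (bu _) (bv _)) (bw _)
  have dif : ∀ {u v : (ℤ → A) → ℝ} (n : ℤ), Measurable u → Measurable v → (∀ x, |u x| ≤ 1) →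
      (∀ x, |v x| ≤ 1) → Integrable (fun x => |u (shiftZ A n x) - v (shiftZ A n x)|) μ :=
    fun n hu hv bu bv => ((integrable_of_abs_le_one (hu.comp (S n)) fun x => bu _).sub
      (integrable_of_abs_le_one (hv.comp (S n)) fun x => bv _)).abs
  have i₁ := dif 0 G₁ K₁ c₁ d₁
  have i₂ := dif a G₂ K₂ c₂ d₂
  have i₃ := dif b G₃ K₃ c₃ d₃
  have i₁₂ : Integrable (fun x => |g₁ (shiftZ A 0 x) - k₁ (shiftZ A 0 x)| +
    |g₂ (shiftZ A a x) - k₂ (shiftZ A a x)|) μ := i₁.add i₂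
  rw [← integral_comp_shiftZ hstat 0 (f := fun x => |g₁ x - k₁ x|) (by fun_prop),
    ← integral_comp_shiftZ hstat a (f := fun x => |g₂ x - k₂ x|) (by fun_prop),
    ← integral_comp_shiftZ hstat b (f := fun x => |g₃ x - k₃ x|) (by fun_prop),
    ← integral_add i₁ i₂, ← integral_add i₁₂ i₃]
  unfold tripleCorr
  rw [← integral_sub (int G₁ G₂ G₃ c₁ c₂ c₃) (int K₁ K₂ K₃ d₁ d₂ d₃)]
  refine abs_integral_le_integral_abs.trans (integral_mono
    ((int G₁ G₂ G₃ c₁ c₂ c₃).sub (int K₁ K₂ K₃ d₁ d₂ d₃)).abs (i₁₂.add i₃) fun x => ?_)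
  simp only [shiftZ_zero]
  exact abs_mul_mul_sub_le (c₂ _) (c₃ _) (d₁ _) (d₂ _)

theorem abs_integral_le_one {Ω : Type*} {m : MeasurableSpace Ω} {μ : Measure Ω}
    [IsProbabilityMeasure μ] {f : Ω → ℝ} (h : ∀ x, |f x| ≤ 1) : |∫ x, f x ∂μ| ≤ 1 := by
  have h' : ∀ x, ‖f x‖ ≤ 1 := h
  simpa using norm_integral_le_of_norm_le_const (μ := μ) (ae_of_all _ h')

/-- Triple correlations of bounded `Π`-measurable functions decouple when `Π` is generated modulo
null sets by a factor which is mixing of order three. -/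
theorem tendsto_tripleCorr_of_measurable_pinskerAlg [Fintype B] [DiscreteMeasurableSpace B]
    {μ : Measure (ℤ → A)} [IsProbabilityMeasure μ]
    (hstat : μ.map (shiftT A) = μ) {ζ0 : (ℤ → A) → B} (hζ0 : Measurable[pinskerAlg A] ζ0)
    (h : ∀ s : Set (ℤ → A), MeasurableSet[pinskerAlg A] s →
      ∃ t : Set (ℤ → A), MeasurableSet[factorAlg A ζ0] t ∧ μ (s ∆ t) = 0)
    (hmix : Mixing3 (μ.map (factorMap ζ0)))
    {g₁ g₂ g₃ : (ℤ → A) → ℝ} (hg₁ : Measurable[pinskerAlg A] g₁)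
    (hg₂ : Measurable[pinskerAlg A] g₂) (hg₃ : Measurable[pinskerAlg A] g₃)
    (c₁ : ∀ x, |g₁ x| ≤ 1) (c₂ : ∀ x, |g₂ x| ≤ 1) (c₃ : ∀ x, |g₃ x| ≤ 1) :
    Tendsto (fun pq : ℕ × ℕ => tripleCorr μ g₁ g₂ g₃ pq.1 (pq.1 + pq.2 : ℤ)) (atTop ×ˢ atTop)
      (nhds ((∫ x, g₁ x ∂μ) * (∫ x, g₂ x ∂μ) * ∫ x, g₃ x ∂μ)) := by
  have hZ : Measurable (factorMap ζ0) :=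
    (measurable_factorMap_pinskerAlg hζ0).mono pinskerAlg_le_pi le_rfl
  have G₁ := hg₁.mono pinskerAlg_le_pi le_rfl
  have G₂ := hg₂.mono pinskerAlg_le_pi le_rfl
  have G₃ := hg₃.mono pinskerAlg_le_pi le_rfl
  rw [Metric.tendsto_nhds]
  intro ε hε
  have hε' : 0 < ε / 8 := by positivity
  obtain ⟨M₁, h₁⟩ := exists_window_approx hζ0 h hg₁ c₁ hε'
  obtain ⟨M₂, h₂⟩ := exists_window_approx hζ0 h hg₂ c₂ hε'
  obtain ⟨M₃, h₃⟩ := exists_window_approx hζ0 h hg₃ c₃ hε'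
  obtain ⟨m, hm⟩ : ∃ m, m = M₁ + M₂ + M₃ := ⟨_, rfl⟩
  obtain ⟨k₁, mk₁, d₁, h₁⟩ := h₁ m (by omega)
  obtain ⟨k₂, mk₂, d₂, h₂⟩ := h₂ m (by omega)
  obtain ⟨k₃, mk₃, d₃, h₃⟩ := h₃ m (by omega)
  have W : ∀ p : ℤ, Measurable fun x => window (2 * m) p (factorMap ζ0 x) := fun p =>
    (measurable_window _ _).comp hZ
  have K₁ := mk₁.comp (W (-m))
  have K₂ := mk₂.comp (W (-m))
  have K₃ := mk₃.comp (W (-m))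
  have hprob : IsProbabilityMeasure (μ.map (factorMap ζ0)) :=
    Measure.isProbabilityMeasure_map hZ.aemeasurable
  have hlim := hmix.tendsto_integral (2 * m) k₁ k₂ k₃
  have single : ∀ {k : (Fin (2 * m + 1) → B) → ℝ}, Measurable k →
      ∫ y, k (window (2 * m) 0 y) ∂(μ.map (factorMap ζ0))
        = ∫ x, k (window (2 * m) (-m) (factorMap ζ0 x)) ∂μ := by
    intro k hk
    rw [integral_map (f := fun y => k (window (2 * m) 0 y)) hZ.aemeasurable
      (hk.comp (measurable_window _ _)).aestronglyMeasurable,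
      ← integral_comp_shiftZ hstat m (f := fun x => k (window (2 * m) (-m) (factorMap ζ0 x)))
      (hk.comp (W (-m)))]
    simp [factorMap_shiftZ, window_shiftZ]
  have triple : ∀ p q : ℕ, ∫ y, k₁ (window (2 * m) 0 y) * k₂ (window (2 * m) p y) *
        k₃ (window (2 * m) ((p : ℤ) + q) y) ∂(μ.map (factorMap ζ0))
      = tripleCorr μ (fun x => k₁ (window (2 * m) (-m) (factorMap ζ0 x)))
        (fun x => k₂ (window (2 * m) (-m) (factorMap ζ0 x)))
        (fun x => k₃ (window (2 * m) (-m) (factorMap ζ0 x))) p (p + q : ℤ) := by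
    intro p q
    have hm : Measurable fun y : ℤ → B => k₁ (window (2 * m) 0 y) * k₂ (window (2 * m) p y) *
        k₃ (window (2 * m) ((p : ℤ) + q) y) :=
      ((mk₁.comp (measurable_window _ _)).mul (mk₂.comp (measurable_window _ _))).mul
        (mk₃.comp (measurable_window _ _))
    have e := integral_comp_shiftZ hstat m ((K₁.mul (K₂.comp (measurable_shiftZ p))).mul
        (K₃.comp (measurable_shiftZ (p + q))))
    refine (integral_map hZ.aemeasurable hm.aestronglyMeasurable).trans (Eq.trans ?_ e)
    simp [factorMap_shiftZ, window_shiftZ]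
  simp_rw [triple, single mk₁, single mk₂, single mk₃] at hlim
  have ii : ∀ {g k : (ℤ → A) → ℝ}, Measurable g → Measurable k → (∀ x, |g x| ≤ 1) →
      (∀ x, |k x| ≤ 1) → |∫ x, g x ∂μ - ∫ x, k x ∂μ| ≤ ∫ x, |g x - k x| ∂μ := by
    intro g k hg hk bg bk
    rw [← integral_sub (integrable_of_abs_le_one hg bg) (integrable_of_abs_le_one hk bk)]
    exact abs_integral_le_integral_abs
  filter_upwards [(Metric.tendsto_nhds.1 hlim) (ε / 8) hε'] with pq hpq
  have t₁ := tripleCorr_sub_le hstat G₁ G₂ G₃ K₁ K₂ K₃ c₁ c₂ c₃ (fun _ => d₁ _) (fun _ => d₂ _)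
    (fun _ => d₃ _) pq.1 (pq.1 + pq.2 : ℤ)
  have t₂ := abs_mul_mul_sub_le (a := ∫ x, g₁ x ∂μ) (c' := ∫ x, k₃ (window (2 * m) (-m)
    (factorMap ζ0 x)) ∂μ) (abs_integral_le_one (μ := μ) c₂) (abs_integral_le_one (μ := μ) c₃)
    (abs_integral_le_one (μ := μ) fun x => d₁ (window (2 * m) (-m) (factorMap ζ0 x)))
    (abs_integral_le_one (μ := μ) fun x => d₂ (window (2 * m) (-m) (factorMap ζ0 x)))
  have s₁ := ii G₁ K₁ c₁ (fun _ => d₁ _)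
  have s₂ := ii G₂ K₂ c₂ (fun _ => d₂ _)
  have s₃ := ii G₃ K₃ c₃ (fun _ => d₃ _)
  simp only [Function.comp_def] at t₁ s₁ s₂ s₃
  rw [Real.dist_eq] at hpq ⊢
  rw [abs_lt] at *
  have t₁' := abs_le.1 t₁
  have t₂' := abs_le.1 t₂
  constructor <;> linarith [t₁'.1, t₁'.2, t₂'.1, t₂'.2, hpq.1, hpq.2]

end Factor

/-- **(3-fold mixing passes from a generator of the Pinsker factor to the process.)**
Let `μ` be a stationary process on `A^ℤ` with Pinsker σ-algebra `Π`, let `B` be a finite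
alphabet, `ζ_0 : A^ℤ → B` a `Π`-measurable random variable, and `ζ_i := ζ_0 ∘ T^i`.
Assume that the σ-algebra generated by `(ζ_i)_{i∈ℤ}` equals `Π` modulo `μ`-null sets.
If the stationary process `ζ` (the pushforward of `μ` under `x ↦ (ζ_i(x))_{i∈ℤ}`)
is 3-fold mixing, then `μ` is 3-fold mixing. -/
theorem mixing3_of_pinsker_generator_mixing3
    {A : Type*} [Fintype A] [MeasurableSpace A] [DiscreteMeasurableSpace A]
    {B : Type*} [Fintype B] [MeasurableSpace B] [DiscreteMeasurableSpace B]
    (μ : Measure (ℤ → A)) [IsProbabilityMeasure μ]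
    (hstat : μ.map (shiftT A) = μ)
    (ζ0 : (ℤ → A) → B)
    (hζ0 : @Measurable _ _ (pinskerAlg A) _ ζ0)
    -- the σ-algebra generated by `(ζ_i)_{i ∈ ℤ}` equals the Pinsker σ-algebra
    -- modulo `μ`-null sets:
    (hG_le : ∀ s : Set (ℤ → A), MeasurableSet[factorAlg A ζ0] s →
      ∃ t : Set (ℤ → A), MeasurableSet[pinskerAlg A] t ∧ μ (s ∆ t) = 0)
    (hle_G : ∀ s : Set (ℤ → A), MeasurableSet[pinskerAlg A] s →
      ∃ t : Set (ℤ → A), MeasurableSet[factorAlg A ζ0] t ∧ μ (s ∆ t) = 0)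
    -- if the factor process `ζ` is 3-fold mixing ...
    (hζmix : Mixing3 (μ.map (fun x (i : ℤ) => ζ0 (shiftZ A i x)))) :
    -- ... then so is `μ`:
    Mixing3 μ := by
  have hW : ∀ (ℓ : ℕ) (p : ℤ) (E : Set (Fin (ℓ + 1) → A)), MeasurableSet {x | window ℓ p x ∈ E} :=
    fun ℓ p E => measurable_window ℓ p E.toFinite.measurableSet
  intro ℓ E1 E2 E3
  set f : Set (Fin (ℓ + 1) → A) → (ℤ → A) → ℝ := fun E =>
    Set.indicator {x | window ℓ 0 x ∈ E} fun _ => 1 with hf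
  have past : ∀ E, Measurable[pastAlg A ℓ] (f E) := fun E =>
    measurable_const.indicator
      (measurable_window_pastAlg (r := ℓ) (by omega) E.toFinite.measurableSet)
  have full : ∀ E, Measurable (f E) := fun E => (past E).mono (pastAlg_le_pi _) le_rfl
  have bdd : ∀ E x, |f E x| ≤ 1 := fun E x => by
    by_cases hx : window ℓ 0 x ∈ E <;> simp [hf, hx]
  have int_f : ∀ E, ∫ x, f E x ∂μ = (μ {x | window ℓ 0 x ∈ E}).toReal := fun E => by
    rw [hf, integral_indicator_const _ (hW ℓ 0 E)]
    simp [Measure.real]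
  have corr_f : ∀ p r : ℤ, tripleCorr μ (f E1) (f E2) (f E3) p r = (μ {x | window ℓ 0 x ∈ E1 ∧
      window ℓ p x ∈ E2 ∧ window ℓ r x ∈ E3}).toReal := fun p r => by
    have e : ∀ x, f E1 x * f E2 (shiftZ A p x) * f E3 (shiftZ A r x) = Set.indicator
        {x | window ℓ 0 x ∈ E1 ∧ window ℓ p x ∈ E2 ∧ window ℓ r x ∈ E3} (fun _ => 1) x := by
      classical
      intro x
      simp only [hf, Set.indicator_apply, Set.mem_ofPred_eq, window_shiftZ, zero_add]
      split_ifs <;> simp_all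
    simp_rw [tripleCorr, e]
    have hm : MeasurableSet {x : ℤ → A | window ℓ 0 x ∈ E1 ∧ window ℓ p x ∈ E2 ∧
        window ℓ r x ∈ E3} := (hW ℓ 0 E1).inter ((hW ℓ p E2).inter (hW ℓ r E3))
    rw [integral_indicator_const _ hm]
    simp [Measure.real]
  obtain ⟨g₁, h₁⟩ := exists_isTailProj μ (full E1) (bdd E1)
  obtain ⟨g₂, h₂⟩ := exists_isTailProj μ (full E2) (bdd E2)
  obtain ⟨g₃, h₃⟩ := exists_isTailProj μ (full E3) (bdd E3)
  have hlim := tendsto_tripleCorr_of_measurable_pinskerAlg hstat hζ0 hle_G hζmix h₁.1 h₂.1 h₃.1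
    h₁.2.1 h₂.2.1 h₃.2.1
  rw [← h₁.integral_eq (full E1) (bdd E1), ← h₂.integral_eq (full E2) (bdd E2),
    ← h₃.integral_eq (full E3) (bdd E3), int_f, int_f, int_f] at hlim
  have hdiff : Tendsto (fun pq : ℕ × ℕ => tripleCorr μ (f E1) (f E2) (f E3) pq.1 (pq.1 + pq.2 : ℤ)
      - tripleCorr μ g₁ g₂ g₃ pq.1 (pq.1 + pq.2 : ℤ)) (atTop ×ˢ atTop) (nhds 0) := by
    rw [Metric.tendsto_nhds]
    intro ε hε
    obtain ⟨N, hN⟩ := tripleCorr_sub_tailProj_le hstat ℓ (past E1) (past E2) (past E3)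
      (bdd E1) (bdd E2) (bdd E3) h₁ h₂ h₃ (ε := ε / 4) (by positivity)
    filter_upwards [(eventually_ge_atTop N).prod_mk (eventually_ge_atTop N)] with pq hpq
    rw [Real.dist_eq, sub_zero]
    exact (hN _ hpq.1 _ hpq.2).trans_lt (by linarith)
  have := (hdiff.add hlim).sub_const ((μ {x | window ℓ 0 x ∈ E1}).toReal *
    (μ {x | window ℓ 0 x ∈ E2}).toReal * (μ {x | window ℓ 0 x ∈ E3}).toReal)
  simpa only [sub_add_cancel, zero_add, sub_self, corr_f] using this
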